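/- ∫_{-1}^{1} cos(cx) J₀(b√(1-x²)) dx = 2 sin(√(b²+c²))/√(b²+c²) for b, c ∈ ℝ with b²+c² > 0. -/

import Mathlib

noncomputable section

/-- The Bessel function of the first kind of order zero, via its standard
integral representation `J₀(x) = (1/π)∫₀^π cos(x sin θ)dθ`. -/
def besselJ0 (x : ℝ) : ℝ :=
  (1 / Real.pi) * ∫ θ in (0:ℝ)..Real.pi, Real.cos (x * Real.sin θ)

open MeasureTheory Set

/-- Lebesgue measure on `(0, π]`. -/
def muPi : Measure ℝ := volume.restrict (Ioc 0 Real.pi)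

instance : IsFiniteMeasure muPi := by unfold muPi; infer_instance

lemma integral_muPi (f : ℝ → ℝ) : ∫ t, f t ∂muPi = ∫ t in (0:ℝ)..Real.pi, f t := by
  rw [intervalIntegral.integral_of_le Real.pi_pos.le]; rfl

/-- Continuous bounded functions on the square are integrable. -/
lemma integrable_bdd (f : ℝ × ℝ → ℝ) (hf : Continuous f) (C : ℝ) (hC : ∀ p, |f p| ≤ C) :
    Integrable f (muPi.prod muPi) :=
  Integrable.of_bound hf.aestronglyMeasurable C (Filter.Eventually.of_forall hC)

/-- The integrand on the sphere. -/
def FF (r φ : ℝ) (p : ℝ × ℝ) : ℝ :=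
  Real.sin p.1 * (Real.cos (r * Real.sin φ * Real.cos p.1) *
    Real.cos (r * Real.cos φ * (Real.sin p.1 * Real.sin p.2)))

def At (r φ : ℝ) (p : ℝ × ℝ) : ℝ :=
  Real.cos p.1 * Real.sin p.2 * (Real.sin (r * Real.sin φ * Real.cos p.1) *
    Real.sin (r * Real.cos φ * (Real.sin p.1 * Real.sin p.2)))
  + Real.sin p.1 * Real.sin p.2 *
   (Real.cos (r * Real.sin φ * Real.cos p.1) * (r * Real.sin φ * -Real.sin p.1) *
    Real.sin (r * Real.cos φ * (Real.sin p.1 * Real.sin p.2))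
   + Real.sin (r * Real.sin φ * Real.cos p.1) *
    (Real.cos (r * Real.cos φ * (Real.sin p.1 * Real.sin p.2)) *
      (r * Real.cos φ * (Real.cos p.1 * Real.sin p.2))))

def Bt (r φ : ℝ) (p : ℝ × ℝ) : ℝ :=
  Real.cos p.1 * -Real.sin p.2 * (Real.sin (r * Real.sin φ * Real.cos p.1) *
    Real.sin (r * Real.cos φ * (Real.sin p.1 * Real.sin p.2)))
  + Real.cos p.1 * Real.cos p.2 *
   (Real.sin (r * Real.sin φ * Real.cos p.1) *
    (Real.cos (r * Real.cos φ * (Real.sin p.1 * Real.sin p.2)) *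
      (r * Real.cos φ * (Real.sin p.1 * Real.cos p.2))))

def FF' (r φ : ℝ) (p : ℝ × ℝ) : ℝ :=
  Real.sin p.1 * (-Real.sin (r * Real.sin φ * Real.cos p.1) * (r * Real.cos φ * Real.cos p.1) *
    Real.cos (r * Real.cos φ * (Real.sin p.1 * Real.sin p.2)) +
    Real.cos (r * Real.sin φ * Real.cos p.1) *
    (-Real.sin (r * Real.cos φ * (Real.sin p.1 * Real.sin p.2)) *
      (r * -Real.sin φ * (Real.sin p.1 * Real.sin p.2))))

lemma FF'_eq (r φ : ℝ) (p : ℝ × ℝ) : FF' r φ p = -(At r φ p + Bt r φ p) := by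
  unfold FF' At Bt
  have h1 := Real.sin_sq_add_cos_sq p.1
  have h2 := Real.sin_sq_add_cos_sq p.2
  generalize Real.sin (r * Real.sin φ * Real.cos p.1) = S1
  generalize Real.cos (r * Real.sin φ * Real.cos p.1) = C1
  generalize Real.sin (r * Real.cos φ * (Real.sin p.1 * Real.sin p.2)) = S2
  generalize Real.cos (r * Real.cos φ * (Real.sin p.1 * Real.sin p.2)) = C2
  have h3 : Real.cos p.2 ^ 2 = 1 - Real.sin p.2 ^ 2 := by linarith
  linear_combination (-(S1*C2*r*Real.cos φ*Real.cos p.1*Real.sin p.1)) * h3*(-1)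

lemma FF_hasDeriv (r φ : ℝ) (p : ℝ × ℝ) : HasDerivAt (fun φ => FF r φ p) (FF' r φ p) φ := by
  have h1 : HasDerivAt (fun φ => r * Real.sin φ * Real.cos p.1)
    (r * Real.cos φ * Real.cos p.1) φ := ((Real.hasDerivAt_sin φ).const_mul r).mul_const _
  have h2 : HasDerivAt (fun φ => r * Real.cos φ * (Real.sin p.1 * Real.sin p.2))
    (r * -Real.sin φ * (Real.sin p.1 * Real.sin p.2)) φ :=
    ((Real.hasDerivAt_cos φ).const_mul r).mul_const _
  exact (h1.cos.mul h2.cos).const_mul _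

lemma At_int (r φ θ : ℝ) : ∫ t in (0:ℝ)..Real.pi, At r φ (t, θ) = 0 := by
  have key : ∀ t, HasDerivAt (fun t => Real.sin t * Real.sin θ *
      (Real.sin (r * Real.sin φ * Real.cos t) *
        Real.sin (r * Real.cos φ * (Real.sin t * Real.sin θ)))) (At r φ (t, θ)) t := by
    intro t
    have h1 : HasDerivAt (fun t => r * Real.sin φ * Real.cos t) (r * Real.sin φ * -Real.sin t) t :=
      (Real.hasDerivAt_cos t).const_mul _
    have h2 : HasDerivAt (fun t => r * Real.cos φ * (Real.sin t * Real.sin θ))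
      (r * Real.cos φ * (Real.cos t * Real.sin θ)) t :=
      ((Real.hasDerivAt_sin t).mul_const _).const_mul _
    exact ((Real.hasDerivAt_sin t).mul_const _).mul (h1.sin.mul h2.sin)
  rw [intervalIntegral.integral_eq_sub_of_hasDerivAt (fun t _ => key t)]
  · simp
  · apply Continuous.intervalIntegrable
    unfold At; fun_prop

lemma Bt_int (r φ t : ℝ) : ∫ θ in (0:ℝ)..Real.pi, Bt r φ (t, θ) = 0 := by
  have key : ∀ θ, HasDerivAt (fun θ => Real.cos t * Real.cos θ *
      (Real.sin (r * Real.sin φ * Real.cos t) *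
        Real.sin (r * Real.cos φ * (Real.sin t * Real.sin θ)))) (Bt r φ (t, θ)) θ := by
    intro θ
    have h2 : HasDerivAt (fun θ => r * Real.cos φ * (Real.sin t * Real.sin θ))
      (r * Real.cos φ * (Real.sin t * Real.cos θ)) θ :=
      ((Real.hasDerivAt_sin θ).const_mul _).const_mul _
    exact ((Real.hasDerivAt_cos θ).const_mul _).mul (h2.sin.const_mul _)
  rw [intervalIntegral.integral_eq_sub_of_hasDerivAt (fun t _ => key t)]
  · simp
  · apply Continuous.intervalIntegrable
    unfold Bt; fun_prop

lemma integrable_cont (f : ℝ × ℝ → ℝ) (hf : Continuous f) :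
    Integrable f (muPi.prod muPi) := by
  unfold muPi
  rw [Measure.prod_restrict]
  exact (hf.continuousOn.integrableOn_compact (isCompact_Icc.prod isCompact_Icc)).mono_set
    (prod_mono Ioc_subset_Icc_self Ioc_subset_Icc_self)

lemma FF'_int (r φ : ℝ) : ∫ p, FF' r φ p ∂(muPi.prod muPi) = 0 := by
  have hA : Integrable (At r φ) (muPi.prod muPi) :=
    integrable_cont _ (by unfold At; fun_prop)
  have hB : Integrable (Bt r φ) (muPi.prod muPi) :=
    integrable_cont _ (by unfold Bt; fun_prop)
  simp_rw [FF'_eq]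
  rw [integral_neg, integral_add hA hB, integral_prod_symm _ hA, integral_prod _ hB]
  simp_rw [integral_muPi, At_int, Bt_int]
  simp

lemma FF'_bound (r φ : ℝ) (p : ℝ × ℝ) : ‖FF' r φ p‖ ≤ 2 * |r| := by
  have hs := Real.abs_sin_le_one
  have hc := Real.abs_cos_le_one
  unfold FF'
  rw [Real.norm_eq_abs, abs_mul]
  have h1 : ∀ a b c d e : ℝ, |a| ≤ 1 → |b| ≤ 1 → |c| ≤ 1 → |d| ≤ 1 → |e| ≤ 1 →
      |a| * (|r| * |b| * (|c| * |e|)) * |d| ≤ |r| := by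
    intro a b c d e ha hb hc hd he
    calc |a| * (|r| * |b| * (|c| * |e|)) * |d| ≤ 1 * (|r| * 1 * (1 * 1)) * 1 := by gcongr
      _ = |r| := by ring
  refine (mul_le_of_le_one_left (abs_nonneg _) (hs _)).trans ((abs_add_le _ _).trans ?_)
  have e1 := h1 (Real.sin (r * Real.sin φ * Real.cos p.1)) (Real.cos φ) (Real.cos p.1)
    (Real.cos (r * Real.cos φ * (Real.sin p.1 * Real.sin p.2))) 1 (hs _) (hc _) (hc _) (hc _)
    (by simp)
  have e2 := h1 (Real.sin (r * Real.cos φ * (Real.sin p.1 * Real.sin p.2))) (Real.sin φ)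
    (Real.sin p.1) (Real.cos (r * Real.sin φ * Real.cos p.1)) (Real.sin p.2)
    (hs _) (hs _) (hs _) (hc _) (hs _)
  simp only [abs_mul, abs_neg, abs_one, mul_one] at e1 e2 ⊢
  linarith

lemma K_deriv (r φ : ℝ) :
    HasDerivAt (fun φ => ∫ p, FF r φ p ∂(muPi.prod muPi)) 0 φ := by
  rw [← FF'_int r φ]
  refine (hasDerivAt_integral_of_dominated_loc_of_deriv_le (bound := fun _ => 2 * |r|)
    (s := univ) Filter.univ_mem ?_ ?_ ?_ ?_ ?_ ?_).2
  · exact Filter.Eventually.of_forall fun x =>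
      (show Continuous (FF r x) by unfold FF; fun_prop).aestronglyMeasurable
  · exact integrable_cont _ (by unfold FF; fun_prop)
  · exact (show Continuous (FF' r φ) by unfold FF'; fun_prop).aestronglyMeasurable
  · exact Filter.Eventually.of_forall fun p x _ => FF'_bound r x p
  · exact integrable_const _
  · exact Filter.Eventually.of_forall fun p x _ => FF_hasDeriv r x p

lemma K_const (r φ ψ : ℝ) :
    ∫ p, FF r φ p ∂(muPi.prod muPi) = ∫ p, FF r ψ p ∂(muPi.prod muPi) :=
  is_const_of_deriv_eq_zero (fun x => (K_deriv r x).differentiableAt)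
    (fun x => (K_deriv r x).deriv) φ ψ

lemma K_iter (r φ : ℝ) : ∫ p, FF r φ p ∂(muPi.prod muPi) =
    ∫ t in (0:ℝ)..Real.pi, ∫ θ in (0:ℝ)..Real.pi, FF r φ (t, θ) := by
  rw [integral_prod _ (integrable_cont _ (by unfold FF; fun_prop))]
  simp_rw [integral_muPi]

lemma K_end (r : ℝ) (hr : 0 < r) : ∫ p, FF r (Real.pi / 2) p ∂(muPi.prod muPi) =
    Real.pi * (2 * Real.sin r / r) := by
  rw [K_iter]
  have : ∀ t : ℝ, ∫ θ in (0:ℝ)..Real.pi, FF r (Real.pi / 2) (t, θ) =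
      Real.pi * (Real.sin t * Real.cos (r * Real.cos t)) := by
    intro t
    simp [FF]
    ring
  simp_rw [this]
  rw [intervalIntegral.integral_const_mul]
  congr 1
  have key : ∀ t, HasDerivAt (fun t => -Real.sin (r * Real.cos t) / r)
      (Real.sin t * Real.cos (r * Real.cos t)) t := by
    intro t
    have := (((Real.hasDerivAt_cos t).const_mul r).sin.neg).div_const r
    have hr' := hr.ne'
    have e : Real.sin t * Real.cos (r * Real.cos t) =
        -(Real.cos (r * Real.cos t) * (r * -Real.sin t)) / r := by
      rw [eq_div_iff hr']
      ring
    rw [e]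
    exact this
  rw [intervalIntegral.integral_eq_sub_of_hasDerivAt (fun t _ => key t)]
  · simp; ring
  · apply Continuous.intervalIntegrable
    fun_prop

lemma continuous_besselJ0 : Continuous besselJ0 := by
  unfold besselJ0
  refine continuous_const.mul ?_
  apply intervalIntegral.continuous_parametric_intervalIntegral_of_continuous'
  fun_prop

/-- `∫_{-1}^{1} cos(cx) J₀(b√(1-x²)) dx = 2 sin(√(b²+c²))/√(b²+c²)` for
`b² + c² > 0`. -/
theorem integral_cos_mul_besselJ0 (b c : ℝ) (hbc : 0 < b ^ 2 + c ^ 2) :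
    (∫ x in (-1:ℝ)..1, Real.cos (c * x) * besselJ0 (b * Real.sqrt (1 - x ^ 2)))
      = 2 * Real.sin (Real.sqrt (b ^ 2 + c ^ 2)) / Real.sqrt (b ^ 2 + c ^ 2) := by
  set r := Real.sqrt (b ^ 2 + c ^ 2) with hr
  have hr0 : 0 < r := Real.sqrt_pos.mpr hbc
  obtain ⟨φ, hb, hc⟩ : ∃ φ : ℝ, b = r * Real.cos φ ∧ c = r * Real.sin φ := by
    have hn : ‖(⟨b, c⟩ : ℂ)‖ = r := by
      rw [Complex.norm_def, Complex.normSq_mk, hr]; congr 1; ring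
    refine ⟨Complex.arg ⟨b, c⟩, ?_, ?_⟩
    · rw [← hn, Complex.norm_mul_cos_arg]
    · rw [← hn, Complex.norm_mul_sin_arg]
  have hcont : Continuous fun x : ℝ =>
      Real.cos (c * x) * besselJ0 (b * Real.sqrt (1 - x ^ 2)) := by
    have := continuous_besselJ0
    fun_prop
  have hsub := intervalIntegral.integral_comp_mul_deriv (a := 0) (b := Real.pi)
    (fun t _ => Real.hasDerivAt_cos t) (by fun_prop) hcont
  rw [Real.cos_zero, Real.cos_pi, intervalIntegral.integral_symm (-1) 1] at hsub
  have h2 : Real.pi * ∫ x in (-1:ℝ)..1, Real.cos (c * x) * besselJ0 (b * Real.sqrt (1 - x ^ 2))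
      = ∫ p, FF r φ p ∂(muPi.prod muPi) := by
    rw [K_iter, ← neg_neg (∫ x in (-1:ℝ)..1, _), ← hsub, ← intervalIntegral.integral_neg,
      ← intervalIntegral.integral_const_mul]
    apply intervalIntegral.integral_congr
    intro t ht
    rw [uIcc_of_le Real.pi_pos.le] at ht
    have hs : Real.sqrt (1 - Real.cos t ^ 2) = Real.sin t := by
      rw [← Real.sin_sq, Real.sqrt_sq (Real.sin_nonneg_of_mem_Icc ht)]
    simp only [Function.comp, FF, besselJ0, hs]
    rw [intervalIntegral.integral_const_mul, intervalIntegral.integral_const_mul, ← hb, ← hc]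
    simp_rw [mul_assoc]
    have := Real.pi_pos.ne'
    field_simp
  rw [K_const r φ (Real.pi / 2), K_end r hr0] at h2
  exact mul_left_cancel₀ Real.pi_pos.ne' h2

end
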